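/- If π is a partition in EO* with even-odd crank eoc(π) = c, then the conjugate partition of π also lies in EO* and has even-odd crank −c. -/

import Mathlib

/-- A partition is a finite multiset of positive integers. -/
def IsPartition (m : Multiset ℕ) : Prop := ∀ x ∈ m, 0 < x

/-- The largest even part of a partition (0 if there are no even parts). -/
def lep (m : Multiset ℕ) : ℕ := (m.filter (fun x => Even x)).sup

/-- `EO*`: every even part is smaller than every odd part, every part other than the
largest even part appears an even number of times, and the largest even part appears
an odd number of times. -/
def EOStar (m : Multiset ℕ) : Prop :=
  IsPartition m ∧
  (∀ x ∈ m, ∀ y ∈ m, Even x → Odd y → x < y) ∧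
  (∀ x ∈ m, x ≠ lep m → Even (m.count x)) ∧
  (∀ x ∈ m, x = lep m → Odd (m.count x))

/-- `E*`: partitions into even parts where each distinct part appears an even number of times. -/
def EStar (m : Multiset ℕ) : Prop :=
  IsPartition m ∧ (∀ x ∈ m, Even x) ∧ ∀ x : ℕ, Even (m.count x)

/-- `O_k*`: partitions into odd parts with exactly `2k` parts where each distinct part
appears an even number of times. -/
def OStar (k : ℕ) (m : Multiset ℕ) : Prop :=
  IsPartition m ∧ (∀ x ∈ m, Odd x) ∧ Multiset.card m = 2 * k ∧ ∀ x : ℕ, Even (m.count x)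

/-- `Q_{k,r}`: partitions with a `(k+r+1) × k` Durfee rectangle whose largest part below
the rectangle is `< k+r+1`; equivalently, exactly `k` parts are `≥ k+r+1`. -/
def QSet (k r : ℕ) (m : Multiset ℕ) : Prop :=
  IsPartition m ∧ Multiset.card (m.filter (fun x => k + r + 1 ≤ x)) = k

/-- `EO*_{k,r}`: partitions in `EO*` with exactly `2k` odd parts and largest even part `2k+2r`. -/
def EOkr (k r : ℕ) (m : Multiset ℕ) : Prop :=
  EOStar m ∧ Multiset.card (m.filter (fun x => Odd x)) = 2 * k ∧ lep m = 2 * k + 2 * r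

/-- The even-odd crank: largest even part minus the number of odd parts. -/
def eoc (m : Multiset ℕ) : ℤ :=
  (lep m : ℤ) - (Multiset.card (m.filter (fun x => Odd x)) : ℤ)

/-- The conjugate partition: its `i`-th part is the number of parts that are `≥ i`. -/
def conjugate (m : Multiset ℕ) : Multiset ℕ :=
  (Multiset.range m.sup).map (fun i => Multiset.card (m.filter (fun x => i + 1 ≤ x)))

/-- An overpartition: a partition together with a set of overlined part values, which must
be a subset of the distinct part values. -/
def IsOverpartition (p : Multiset ℕ × Finset ℕ) : Prop :=
  IsPartition p.1 ∧ p.2 ⊆ p.1.toFinset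

theorem Multiset.sup_mem_or_eq_zero (s : Multiset ℕ) : s.sup ∈ s ∨ s.sup = 0 := by
  induction s using Multiset.induction with
  | empty => simp
  | cons a s ih =>
    rw [Multiset.sup_cons, Multiset.mem_cons]
    rcases le_total a s.sup with h | h
    · rw [sup_eq_right.2 h]
      tauto
    · rw [sup_eq_left.2 h]
      tauto

theorem Multiset.even_card_of_even_count {α : Type*} [DecidableEq α] {s : Multiset α}
    (h : ∀ x ∈ s, Even (s.count x)) : Even (Multiset.card s) := by
  rw [← Multiset.toFinset_sum_count_eq]
  exact Finset.even_sum _ fun x hx => h x (Multiset.mem_toFinset.1 hx)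

theorem Multiset.even_count_map_range {f : ℕ → ℕ} (a : ℕ)
    (h : ∀ j < a, f (2 * j) = f (2 * j + 1)) (v : ℕ) :
    Even (((Multiset.range (2 * a)).map f).count v) := by
  induction a with
  | zero => simp
  | succ a ih =>
    have hf := h a (by omega)
    have := ih fun j hj => h j (by omega)
    rw [show 2 * (a + 1) = 2 * a + 1 + 1 by ring, Multiset.range_succ, Multiset.range_succ,
      Multiset.map_cons, Multiset.map_cons, Multiset.count_cons, Multiset.count_cons, ← hf]
    split_ifs <;> grind

theorem Multiset.map_range_add {α : Type*} (f : ℕ → α) (a b : ℕ) :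
    (Multiset.range (a + b)).map f =
      (Multiset.range a).map f + (Multiset.range b).map fun i => f (a + i) := by
  rw [Multiset.range_add, Multiset.map_add, Multiset.map_map]
  rfl

theorem Multiset.count_map_range_succ {α : Type*} [DecidableEq α] (f : ℕ → α) (b : ℕ) (v : α) :
    ((Multiset.range (b + 1)).map f).count v =
      ((Multiset.range b).map fun i => f (i + 1)).count v + if v = f 0 then 1 else 0 := by
  rw [add_comm b 1, Multiset.map_range_add f 1 b, Multiset.count_add, add_comm]
  simp [add_comm, Multiset.count_singleton]

/-- The number of parts of `m` that are greater than `i`. -/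
def numGT (m : Multiset ℕ) (i : ℕ) : ℕ := Multiset.card (m.filter (fun x => i + 1 ≤ x))

theorem conjugate_eq_map_numGT (m : Multiset ℕ) :
    conjugate m = (Multiset.range m.sup).map (numGT m) := rfl

theorem numGT_antitone (m : Multiset ℕ) : Antitone (numGT m) := fun _ _ h =>
  Multiset.card_le_card (Multiset.monotone_filter_right m fun _ hx => by omega)

theorem numGT_pos {m : Multiset ℕ} {i : ℕ} (h : i < m.sup) : 0 < numGT m i := by
  rcases m.sup_mem_or_eq_zero with hs | hs
  · exact Multiset.card_pos_iff_exists_mem.2 ⟨_, Multiset.mem_filter.2 ⟨hs, h⟩⟩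
  · omega

theorem numGT_eq_zero {m : Multiset ℕ} {i : ℕ} (h : m.sup ≤ i) : numGT m i = 0 := by
  rw [numGT, Multiset.card_eq_zero, Multiset.filter_eq_nil]
  intro x hx
  have := Multiset.le_sup hx
  omega

theorem numGT_succ {m : Multiset ℕ} {i : ℕ} (h : i + 1 ∉ m) : numGT m i = numGT m (i + 1) := by
  refine congrArg Multiset.card (Multiset.filter_congr fun x hx => ?_)
  have : x ≠ i + 1 := fun e => h (e ▸ hx)
  omega

theorem lep_mem_or_eq_zero (m : Multiset ℕ) : lep m ∈ m ∨ lep m = 0 :=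
  (m.filter (fun x => Even x)).sup_mem_or_eq_zero.imp_left Multiset.mem_of_mem_filter

theorem even_lep (m : Multiset ℕ) : Even (lep m) := by
  rcases (m.filter (fun x => Even x)).sup_mem_or_eq_zero with h | h
  · exact (Multiset.mem_filter.1 h).2
  · rw [lep, h]
    exact Even.zero

theorem le_lep {m : Multiset ℕ} {x : ℕ} (hx : x ∈ m) (he : Even x) : x ≤ lep m :=
  Multiset.le_sup (Multiset.mem_filter.2 ⟨hx, he⟩)

theorem numGT_succ_of_lep_le {m : Multiset ℕ} {i : ℕ} (hi : lep m ≤ i) (ho : Odd i) :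
    numGT m i = numGT m (i + 1) :=
  numGT_succ fun hm => by
    have := le_lep hm ho.add_one
    omega

theorem lep_le_sup (m : Multiset ℕ) : lep m ≤ m.sup :=
  Multiset.sup_mono (Multiset.filter_subset _ m)

theorem conjugate_eq_add (m : Multiset ℕ) :
    conjugate m = (Multiset.range (lep m)).map (numGT m) +
      (Multiset.range (m.sup - lep m)).map fun i => numGT m (lep m + i) := by
  rw [← Multiset.map_range_add, Nat.add_sub_cancel' (lep_le_sup m), conjugate_eq_map_numGT]

namespace EOStar

variable {m : Multiset ℕ}

theorem odd_iff_lep_lt (h : EOStar m) {x : ℕ} (hx : x ∈ m) : Odd x ↔ lep m < x := by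
  refine ⟨fun ho => ?_, fun hl => ?_⟩
  · rcases lep_mem_or_eq_zero m with hm | hm
    · exact h.2.1 _ hm _ hx (even_lep m) ho
    · rw [hm]
      exact h.1 x hx
  · by_contra hn
    exact absurd (le_lep hx (Nat.not_odd_iff_even.1 hn)) (by omega)

theorem numGT_lep (h : EOStar m) :
    numGT m (lep m) = Multiset.card (m.filter (fun x => Odd x)) :=
  congrArg _ (Multiset.filter_congr fun _ hx => (h.odd_iff_lep_lt hx).symm)

theorem even_numGT (h : EOStar m) {i : ℕ} (hi : lep m ≤ i) : Even (numGT m i) := by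
  refine Multiset.even_card_of_even_count fun x hx => ?_
  obtain ⟨hm, hx⟩ := Multiset.mem_filter.1 hx
  rw [Multiset.count_filter_of_pos hx]
  exact h.2.2.1 x hm (by omega)

theorem odd_numGT (h : EOStar m) {i : ℕ} (hi : i < lep m) : Odd (numGT m i) := by
  have hL : lep m ∈ m := (lep_mem_or_eq_zero m).resolve_right (by omega)
  rw [numGT, ← Multiset.filter_add_not (fun x => lep m = x) (m.filter _), Multiset.card_add,
    ← Multiset.countP_eq_card_filter]
  refine Odd.add_even ?_ (Multiset.even_card_of_even_count fun x hx => ?_)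
  · change Odd (Multiset.count (lep m) _)
    rw [Multiset.count_filter_of_pos (by omega)]
    exact h.2.2.2 _ hL rfl
  · obtain ⟨hx, hne⟩ := Multiset.mem_filter.1 hx
    obtain ⟨hm, hx⟩ := Multiset.mem_filter.1 hx
    rw [Multiset.count_filter_of_pos (by exact hne), Multiset.count_filter_of_pos hx]
    exact h.2.2.1 x hm fun e => hne e.symm

theorem numGT_succ_of_lt_lep (h : EOStar m) {i : ℕ} (hi : i < lep m) (he : Even i) :
    numGT m i = numGT m (i + 1) :=
  numGT_succ fun hm => by
    have := (h.odd_iff_lep_lt hm).1 he.add_one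
    omega

theorem odd_sup (h : EOStar m) (hlt : lep m < m.sup) : Odd m.sup := by
  have hs := m.sup_mem_or_eq_zero.resolve_right (by omega)
  exact (h.odd_iff_lep_lt hs).2 hlt

theorem filter_even_conjugate (h : EOStar m) : (conjugate m).filter (fun x => Even x) =
    (Multiset.range (m.sup - lep m)).map fun i => numGT m (lep m + i) := by
  rw [conjugate_eq_add, Multiset.filter_add, Multiset.filter_eq_nil.2, Multiset.filter_eq_self.2,
    zero_add]
  · simp only [Multiset.mem_map]
    rintro _ ⟨i, -, rfl⟩
    exact h.even_numGT (by omega)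
  · simp only [Multiset.mem_map, Multiset.mem_range]
    rintro _ ⟨i, hi, rfl⟩
    exact Nat.not_even_iff_odd.2 (h.odd_numGT hi)

theorem filter_odd_conjugate (h : EOStar m) : (conjugate m).filter (fun x => Odd x) =
    (Multiset.range (lep m)).map (numGT m) := by
  rw [conjugate_eq_add, Multiset.filter_add, Multiset.filter_eq_self.2, Multiset.filter_eq_nil.2,
    add_zero]
  · simp only [Multiset.mem_map]
    rintro _ ⟨i, -, rfl⟩
    exact Nat.not_odd_iff_even.2 (h.even_numGT (by omega))
  · simp only [Multiset.mem_map, Multiset.mem_range]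
    rintro _ ⟨i, hi, rfl⟩
    exact h.odd_numGT hi

theorem lep_conjugate (h : EOStar m) : lep (conjugate m) = numGT m (lep m) := by
  rw [lep, h.filter_even_conjugate]
  apply le_antisymm
  · simp only [Multiset.sup_le, Multiset.mem_map]
    rintro _ ⟨i, -, rfl⟩
    exact numGT_antitone m (by omega)
  · rcases lt_or_ge (lep m) m.sup with hlt | hge
    · exact Multiset.le_sup
        (Multiset.mem_map.2 ⟨0, Multiset.mem_range.2 (by omega), rfl⟩)
    · rw [numGT_eq_zero hge]
      exact Nat.zero_le _

theorem odd_count_conjugate_iff (h : EOStar m) {v : ℕ} (hv : v ∈ conjugate m) :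
    Odd ((conjugate m).count v) ↔ v = lep (conjugate m) := by
  obtain ⟨a, ha⟩ := (even_lep m).two_dvd
  have hA : Even (((Multiset.range (lep m)).map (numGT m)).count v) := by
    nth_rw 1 [ha]
    exact Multiset.even_count_map_range a
      (fun j hj => h.numGT_succ_of_lt_lep (by omega) (even_two_mul j)) v
  have hpos : 0 < v := by
    rw [conjugate_eq_map_numGT, Multiset.mem_map] at hv
    obtain ⟨i, hi, rfl⟩ := hv
    exact numGT_pos (Multiset.mem_range.1 hi)
  rw [h.lep_conjugate, conjugate_eq_add, Multiset.count_add]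
  rcases (lep_le_sup m).lt_or_eq with hlt | heq
  · obtain ⟨b, hb⟩ := h.odd_sup hlt
    have hB := Multiset.even_count_map_range (f := fun i => numGT m (lep m + (i + 1))) (b - a)
      (fun j _ => numGT_succ_of_lep_le (by omega) (by rw [ha]; exact ⟨a + j, by ring⟩)) v
    rw [show m.sup - lep m = 2 * (b - a) + 1 by omega, Multiset.count_map_range_succ, add_zero]
    split_ifs with hvL <;> simp [hvL, ← Nat.not_even_iff_odd] <;> grind
  · rw [heq, Nat.sub_self, numGT_eq_zero le_rfl, Multiset.range_zero, Multiset.map_zero,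
      Multiset.count_zero, add_zero, ← heq, ← Nat.not_even_iff_odd]
    exact iff_of_false (not_not.2 hA) hpos.ne'

protected theorem conjugate (h : EOStar m) : EOStar (conjugate m) := by
  refine ⟨fun v hv => ?_, fun x hx y hy he ho => ?_, fun v hv hne => ?_,
    fun v hv => (h.odd_count_conjugate_iff hv).2⟩
  · rw [conjugate_eq_map_numGT, Multiset.mem_map] at hv
    obtain ⟨i, hi, rfl⟩ := hv
    exact numGT_pos (Multiset.mem_range.1 hi)
  · have hxN := le_lep hx he
    rw [h.lep_conjugate] at hxN
    have hy := Multiset.mem_filter.2 ⟨hy, ho⟩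
    rw [h.filter_odd_conjugate, Multiset.mem_map] at hy
    obtain ⟨i, hi, rfl⟩ := hy
    refine lt_of_le_of_ne
      (hxN.trans (numGT_antitone m (Multiset.mem_range.1 hi).le)) fun e => ?_
    exact Nat.not_even_iff_odd.2 ho (e ▸ he)
  · exact Nat.not_odd_iff_even.1 fun ho => hne ((h.odd_count_conjugate_iff hv).1 ho)

theorem eoc_conjugate (h : EOStar m) : eoc (conjugate m) = -eoc m := by
  rw [eoc, eoc, h.lep_conjugate, h.filter_odd_conjugate, Multiset.card_map, Multiset.card_range,
    h.numGT_lep, neg_sub]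

end EOStar

/-- If `π ∈ EO*` has even-odd crank `c`, then its conjugate is also in `EO*` and has
even-odd crank `-c`. -/
theorem stmt6 (m : Multiset ℕ) (c : ℤ) (h : EOStar m) (hc : eoc m = c) :
    EOStar (conjugate m) ∧ eoc (conjugate m) = -c := by
  rw [← hc]
  exact ⟨h.conjugate, h.eoc_conjugate⟩
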